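/- (Linear contraction of optimality gap on true successful steps, controllable noise.) Let f be C² with λ₁ I ⪯ ∇²f(x) ⪯ λₙ I, minimizer x*, f* = f(x*). Assume: f̃(x+ts) ≤ f̃(x) + c t sᵀg; |f(x) − f̃(x)| ≤ −θ t sᵀg and |f(x+ts) − f̃(x+ts)| ≤ −θ t sᵀg with 0 < θ < c/2; −gᵀs ≥ βκ₁²‖g‖²; ‖∇f(x)‖ ≤ (1 + tη)‖g‖ with η ≤ 1 and 0 < t ≤ t_max. Then f(x+ts) − f* ≤ (1 − 2βκ₁²λ₁(c − 2θ) t/(1 + t_max)²)(f(x) − f*). -/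

import Mathlib

open scoped RealInnerProductSpace

/-- Quadratic lower bound from a Hessian lower bound. -/
theorem quad_lower {E : Type*} [NormedAddCommGroup E] [InnerProductSpace ℝ E] [CompleteSpace E]
    (f : E → ℝ) (m : ℝ) (hf : ContDiff ℝ 2 f)
    (hH : ∀ y v, m * ‖v‖ ^ 2 ≤ ⟪v, fderiv ℝ (gradient f) y v⟫) (x v : E) :
    f x + ⟪gradient f x, v⟫ + m * ‖v‖ ^ 2 / 2 ≤ f (x + v) := by
  have hfd : Differentiable ℝ f := hf.differentiable (by norm_num)
  have hgd : Differentiable ℝ (gradient f) := by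
    have h1 : ContDiff ℝ 1 (fderiv ℝ f) := hf.fderiv_right (by norm_num)
    have h2 : Differentiable ℝ (fderiv ℝ f) := h1.differentiable (by norm_num)
    exact (InnerProductSpace.toDual ℝ E).symm.toContinuousLinearEquiv.differentiable.comp h2
  have hl : ∀ r : ℝ, HasDerivAt (fun r : ℝ => x + r • v) v r := by
    intro r
    simpa using ((hasDerivAt_id r).smul_const v).const_add x
  have hphi : ∀ r : ℝ, HasDerivAt (fun r : ℝ => f (x + r • v)) ⟪gradient f (x + r • v), v⟫ r := by
    intro r
    have h := (hfd (x + r • v)).hasGradientAt.hasFDerivAt.comp_hasDerivAt r (hl r)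
    refine HasDerivAt.congr_deriv (f := fun r : ℝ => f (x + r • v)) h ?_
    simp
  have hg : ∀ r : ℝ, HasDerivAt (fun r : ℝ => ⟪gradient f (x + r • v), v⟫)
      ⟪v, fderiv ℝ (gradient f) (x + r • v) v⟫ r := by
    intro r
    have h := (hgd (x + r • v)).hasFDerivAt.comp_hasDerivAt r (hl r)
    have h' := h.inner ℝ (hasDerivAt_const r v)
    simpa [real_inner_comm] using h'
  have hpsi : ∀ r : ℝ, HasDerivAt (fun r : ℝ => ⟪gradient f (x + r • v), v⟫ - (m * ‖v‖ ^ 2) * r)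
      (⟪v, fderiv ℝ (gradient f) (x + r • v) v⟫ - (m * ‖v‖ ^ 2)) r := by
    intro r
    have h := (hg r).sub ((hasDerivAt_id r).const_mul (m * ‖v‖ ^ 2))
    refine h.congr_deriv ?_
    simp
  have hmono := monotone_of_hasDerivAt_nonneg hpsi
    (fun r => sub_nonneg.2 (hH (x + r • v) v))
  have hchi : ∀ r : ℝ, HasDerivAt
      (fun r : ℝ => f (x + r • v) - (m * ‖v‖ ^ 2 / 2) * r ^ 2 - ⟪gradient f x, v⟫ * r)
      (⟪gradient f (x + r • v), v⟫ - (m * ‖v‖ ^ 2) * r - ⟪gradient f x, v⟫) r := by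
    intro r
    have h := ((hphi r).sub (((hasDerivAt_id r).pow 2).const_mul (m * ‖v‖ ^ 2 / 2))).sub
      ((hasDerivAt_id r).const_mul ⟪gradient f x, v⟫)
    refine h.congr_deriv ?_
    simp
    ring
  have hmono2 : MonotoneOn
      (fun r : ℝ => f (x + r • v) - (m * ‖v‖ ^ 2 / 2) * r ^ 2 - ⟪gradient f x, v⟫ * r)
      (Set.Icc 0 1) := by
    refine monotoneOn_of_deriv_nonneg (convex_Icc 0 1)
      (fun r _ => (hchi r).continuousAt.continuousWithinAt)
      (fun r _ => (hchi r).differentiableAt.differentiableWithinAt) ?_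
    intro r hr
    rw [interior_Icc] at hr
    rw [(hchi r).deriv]
    have := hmono hr.1.le
    simp only [zero_smul, add_zero, mul_zero, sub_zero] at this
    linarith
  have := hmono2 (by simp) (by simp) (zero_le_one)
  simp only [zero_smul, one_smul, add_zero, mul_zero, sub_zero, mul_one, one_pow, ne_eq,
    OfNat.ofNat_ne_zero, not_false_eq_true, zero_pow] at this
  linarith

/-- Linear contraction of the optimality gap on true successful steps (controllable noise). -/
theorem stmt_10 {n : ℕ} (f ftil : EuclideanSpace ℝ (Fin n) → ℝ)
    (lam1 lamn c theta beta kappa1 eta t tmax : ℝ)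
    (x xstar s g : EuclideanSpace ℝ (Fin n))
    (hlam1 : 0 < lam1) (hlamn : lam1 ≤ lamn)
    (hf : ContDiff ℝ 2 f)
    (hHess : ∀ y v, lam1 * ‖v‖ ^ 2 ≤ ⟪v, fderiv ℝ (gradient f) y v⟫ ∧
      ⟪v, fderiv ℝ (gradient f) y v⟫ ≤ lamn * ‖v‖ ^ 2)
    (hmin : ∀ y, f xstar ≤ f y)
    (hc : 0 < c) (hc1 : c < 1) (htheta0 : 0 < theta) (htheta : theta < c / 2)
    (hbeta : 0 < beta) (hkappa1 : 0 < kappa1)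
    (harmijo : ftil (x + t • s) ≤ ftil x + c * t * ⟪s, g⟫)
    (hnoise1 : |f x - ftil x| ≤ -(theta * t * ⟪s, g⟫))
    (hnoise2 : |f (x + t • s) - ftil (x + t • s)| ≤ -(theta * t * ⟪s, g⟫))
    (hs2 : -⟪g, s⟫ ≥ beta * kappa1 ^ 2 * ‖g‖ ^ 2)
    (hacc : ‖gradient f x‖ ≤ (1 + t * eta) * ‖g‖)
    (heta0 : 0 < eta) (heta : eta ≤ 1)
    (ht0 : 0 < t) (ht : t ≤ tmax) :
    f (x + t • s) - f xstar ≤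
      (1 - 2 * beta * kappa1 ^ 2 * lam1 * (c - 2 * theta) * t / (1 + tmax) ^ 2) *
        (f x - f xstar) := by
  have hpl : 2 * lam1 * (f x - f xstar) ≤ ‖gradient f x‖ ^ 2 := by
    have h := quad_lower f lam1 hf (fun y v => (hHess y v).1) x (xstar - x)
    rw [add_sub_cancel] at h
    have h2 := (abs_le.1 (abs_real_inner_le_norm (gradient f x) (xstar - x))).1
    nlinarith [sq_nonneg (‖gradient f x‖ - lam1 * ‖xstar - x‖)]
  have hA : ‖gradient f x‖ ^ 2 ≤ (1 + tmax) ^ 2 * ‖g‖ ^ 2 := by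
    rw [← mul_pow]
    refine pow_le_pow_left₀ (norm_nonneg _) (hacc.trans ?_) 2
    refine mul_le_mul_of_nonneg_right ?_ (norm_nonneg _)
    nlinarith
  have hT : 0 < (1 + tmax) ^ 2 := by
    have : 0 < 1 + tmax := by linarith
    positivity
  have hB : 2 * lam1 * (f x - f xstar) / (1 + tmax) ^ 2 ≤ ‖g‖ ^ 2 := by
    rw [div_le_iff₀ hT]
    linarith
  rw [real_inner_comm] at hs2
  have h1 := (abs_le.1 hnoise1).1
  have h2 := (abs_le.1 hnoise2).2
  have hK : 0 ≤ (c - 2 * theta) * t := mul_nonneg (by linarith) ht0.le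
  have h3 := mul_le_mul_of_nonneg_left hs2 hK
  have h4 := mul_le_mul_of_nonneg_left hB
    (mul_nonneg hK (mul_nonneg hbeta.le (sq_nonneg kappa1)))
  have h5 : (1 - 2 * beta * kappa1 ^ 2 * lam1 * (c - 2 * theta) * t / (1 + tmax) ^ 2) *
        (f x - f xstar) = (f x - f xstar) - (c - 2 * theta) * t * (beta * kappa1 ^ 2) *
        (2 * lam1 * (f x - f xstar) / (1 + tmax) ^ 2) := by ring
  rw [h5]
  have h6 : f (x + t • s) ≤ f x + (c - 2 * theta) * t * ⟪s, g⟫ := by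
    have h1' := (abs_le.1 hnoise1).1
    linarith
  linarith
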